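/- Let k ≥ 2 and let (M_1, …, M_k) be an anarchy harmonious k-tuple with K = ω(M_1 ⋯ M_k), and let P be the set of all prime factors of M_1 ⋯ M_k. Then σ(M_1 ⋯ M_k) · Φ(P)/Π(P) ≤ F_{2K}(2) · 2^{−2·2^K}. -/

import Mathlib

/-- `sigma n` is the sum of all positive divisors of `n`. -/
def sigma (n : ℕ) : ℕ := ∑ d ∈ n.divisors, d

/-- `F r x = x ^ (2 ^ r) - x ^ (2 ^ (r - 1))` for `r ≥ 1`, and `F 0 x = x - 1`. -/
noncomputable def F (r : ℕ) (x : ℝ) : ℝ :=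
  if r = 0 then x - 1 else x ^ (2 ^ r) - x ^ (2 ^ (r - 1))

/-- `PiS S = ∏_{m ∈ S} m`. -/
def PiS (S : Finset ℕ) : ℕ := ∏ m ∈ S, m

/-- `PhiS S = ∏_{m ∈ S} (m - 1)`. -/
def PhiS (S : Finset ℕ) : ℕ := ∏ m ∈ S, (m - 1)

open Finset

lemma F_succ (r : ℕ) (x : ℝ) : F (r + 1) x = x ^ (2 ^ r) * (x ^ (2 ^ r) - 1) := by
  simp only [F, Nat.succ_ne_zero, if_false, Nat.add_sub_cancel, pow_succ, pow_mul]
  ring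

lemma F_succ_mono (r : ℕ) {x y : ℝ} (hx : 1 ≤ x) (hxy : x ≤ y) : F (r + 1) x ≤ F (r + 1) y := by
  rw [F_succ, F_succ]
  have h : x ^ (2 ^ r) ≤ y ^ (2 ^ r) := pow_le_pow_left₀ (by linarith) hxy _
  have h1 : 1 ≤ x ^ (2 ^ r) := one_le_pow₀ hx
  exact mul_le_mul h (by linarith) (by linarith) (by linarith)

lemma F_succ_pow (r n : ℕ) (x : ℝ) : F (r + 1) (x ^ (2 ^ n)) = F (n + (r + 1)) x := by
  rw [F_succ, ← add_assoc, F_succ, ← pow_mul, ← pow_add]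

lemma F_add_one_le (n : ℕ) {x : ℝ} (hx : 1 ≤ x) : F n x + 1 ≤ x ^ (2 ^ n) := by
  rcases n with _ | n
  · simp [F]
  · rw [F_succ, pow_succ, pow_mul, pow_two]
    have h1 : 1 ≤ x ^ (2 ^ n) := one_le_pow₀ hx
    nlinarith

lemma le_sum_mul_of_antitone (c d : ℕ → ℝ) (n : ℕ)
    (hc : ∀ i < n, c (i + 1) ≤ c i)
    (hd : ∀ l ≤ n, 0 ≤ ∑ i ∈ range (l + 1), d i) :
    c n * ∑ i ∈ range (n + 1), d i ≤ ∑ i ∈ range (n + 1), c i * d i := by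
  induction n with
  | zero => simp
  | succ n ih =>
    have h := ih (fun i hi => hc i (by omega)) (fun l hl => hd l (by omega))
    rw [sum_range_succ _ (n + 1), sum_range_succ _ (n + 1)]
    have h2 := mul_le_mul_of_nonneg_right (hc n (by omega)) (hd n (by omega))
    linarith

/-- A multiplicative majorization principle: if `ψ` is decreasing and log-convex in `log m`, then
lower bounds for the tails of `∏ ψ (m i)` bound `∏ m i` from above. -/
lemma prod_le_prod_of_tail (r : ℕ) (m y : ℕ → ℝ) (c ψ : ℝ → ℝ)
    (hm : ∀ i < r, 0 < m i) (hy : ∀ i < r, 0 < y i)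
    (hψm : ∀ i < r, 0 < ψ (m i)) (hψy : ∀ i < r, 0 < ψ (y i))
    (hc : ∀ i, i + 1 < r → c (m (i + 1)) ≤ c (m i)) (hc0 : ∀ i < r, 0 < c (m i))
    (hconv : ∀ i < r, Real.log (ψ (m i)) - Real.log (ψ (y i)) ≤
      c (m i) * (Real.log (y i) - Real.log (m i)))
    (htail : ∀ j < r, ∏ i ∈ range j, m i ≤ ∏ i ∈ range j, y i →
      ∏ i ∈ Ico j r, ψ (y i) ≤ ∏ i ∈ Ico j r, ψ (m i)) :
    ∏ i ∈ range r, m i ≤ ∏ i ∈ range r, y i := by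
  by_contra hcon
  push Not at hcon
  have hr : 0 < r := by
    rcases Nat.eq_zero_or_pos r with h | h
    · subst h; simp at hcon
    · exact h
  classical
  obtain ⟨j, hj, hmax⟩ := exists_max_image
    ((range r).filter (fun j => ∏ i ∈ range j, m i ≤ ∏ i ∈ range j, y i)) id ⟨0, by simp [hr]⟩
  simp only [mem_filter, mem_range, id] at hj hmax
  obtain ⟨hjr, hje⟩ := hj
  obtain ⟨n, rfl⟩ : ∃ n, r = j + (n + 1) := ⟨r - j - 1, by omega⟩
  have hgt : ∀ l ≤ n, ∏ i ∈ range (j + (l + 1)), y i < ∏ i ∈ range (j + (l + 1)), m i := by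
    intro l hl
    rcases hl.lt_or_eq with h | h
    · by_contra h'
      have := hmax (j + (l + 1)) ⟨by omega, not_lt.1 h'⟩
      omega
    · rw [h]; exact hcon
  have hsum : ∀ l ≤ n,
      0 < ∑ i ∈ range (l + 1), (Real.log (m (j + i)) - Real.log (y (j + i))) := by
    intro l hl
    have h1 := hgt l hl
    rw [prod_range_add _ j (l + 1), prod_range_add _ j (l + 1)] at h1
    have hpm : 0 < ∏ i ∈ range j, m i := prod_pos fun i hi => hm i (by simp at hi; omega)
    have hpm' : 0 < ∏ i ∈ range (l + 1), m (j + i) :=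
      prod_pos fun i hi => hm _ (by simp at hi; omega)
    have hpy : 0 < ∏ i ∈ range (l + 1), y (j + i) :=
      prod_pos fun i hi => hy _ (by simp at hi; omega)
    have h2 : ∏ i ∈ range (l + 1), y (j + i) < ∏ i ∈ range (l + 1), m (j + i) := by
      by_contra h'
      push Not at h'
      exact absurd (mul_le_mul hje h' hpm'.le (hpm.le.trans hje)) (not_le.2 h1)
    rw [sum_sub_distrib, sub_pos, ← Real.log_prod, ← Real.log_prod]
    · exact Real.log_lt_log hpy h2
    · intro i hi; exact (hm _ (by simp at hi; omega)).ne'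
    · intro i hi; exact (hy _ (by simp at hi; omega)).ne'
  have hmain := le_sum_mul_of_antitone (fun i => c (m (j + i)))
    (fun i => Real.log (m (j + i)) - Real.log (y (j + i))) n
    (fun i hi => hc (j + i) (by omega)) (fun l hl => (hsum l hl).le)
  have hpos := mul_pos (hc0 (j + n) (by omega)) (hsum n le_rfl)
  have ht := htail j hjr hje
  rw [prod_Ico_eq_prod_range, prod_Ico_eq_prod_range, Nat.add_sub_cancel_left] at ht
  have hlog := Real.log_le_log
    (prod_pos fun i hi => hψy (j + i) (by simp at hi; omega)) ht
  rw [Real.log_prod fun i hi => (hψy (j + i) (by simp at hi; omega)).ne',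
    Real.log_prod fun i hi => (hψm (j + i) (by simp at hi; omega)).ne'] at hlog
  have hle : ∑ i ∈ range (n + 1), (Real.log (ψ (m (j + i))) - Real.log (ψ (y (j + i)))) ≤
      ∑ i ∈ range (n + 1), -(c (m (j + i)) * (Real.log (m (j + i)) - Real.log (y (j + i)))) := by
    refine sum_le_sum fun i hi => ?_
    have := hconv (j + i) (by simp at hi; omega)
    linarith
  rw [sum_sub_distrib, sum_neg_distrib] at hle
  linarith

lemma mul_log_sub_log_le {a b : ℝ} (ha : 0 < a) (hb : 0 < b) :
    a * (Real.log b - Real.log a) ≤ (a + 1) * (Real.log (b + 1) - Real.log (a + 1)) := by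
  have h := strictConcaveOn_log_Ioi.concaveOn.2 (show b / a ∈ Set.Ioi 0 from div_pos hb ha)
    (show (1 : ℝ) ∈ Set.Ioi 0 from Set.mem_Ioi.2 one_pos) (show 0 ≤ a / (a + 1) by positivity)
    (show 0 ≤ 1 / (a + 1) by positivity) (by field_simp)
  have h1 : (a / (a + 1)) • (b / a) + (1 / (a + 1)) • (1 : ℝ) = (b + 1) / (a + 1) := by
    simp only [smul_eq_mul]; field_simp
  rw [h1, Real.log_div (by positivity) (by positivity), Real.log_div (by positivity)
    (by positivity), Real.log_one, smul_zero, add_zero, smul_eq_mul, div_mul_eq_mul_div,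
    div_le_iff₀ (by positivity)] at h
  linarith

/-- The telescoping factor `X ^ (2 ^ j) / (X ^ (2 ^ j) - 1)`. -/
lemma prod_Ico_one_add_inv_pow (X : ℝ) (hX : 1 < X) (n j : ℕ) (hj : j ≤ n) :
    (∏ i ∈ Ico j n, (X ^ (2 ^ i) + 1) / X ^ (2 ^ i)) * (X ^ (2 ^ n) / (X ^ (2 ^ n) - 1)) =
      X ^ (2 ^ j) / (X ^ (2 ^ j) - 1) := by
  induction n, hj using Nat.le_induction with
  | base => simp
  | succ n hjn ih =>
    rw [prod_Ico_succ_top hjn, ← ih, mul_assoc]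
    congr 1
    have h1 : 1 < X ^ (2 ^ n) := one_lt_pow₀ hX (by positivity)
    rw [pow_succ, pow_mul]
    generalize X ^ (2 ^ n) = Z at *
    have h2 : Z - 1 ≠ 0 := by linarith
    have h3 : Z ^ 2 - 1 ≠ 0 := by nlinarith
    have h4 : Z ≠ 0 := by linarith
    field_simp
    ring

lemma mul_prod_pow_add_one (X : ℝ) (n : ℕ) :
    (X - 1) * ∏ i ∈ range n, (X ^ (2 ^ i) + 1) = X ^ (2 ^ n) - 1 := by
  induction n with
  | zero => simp
  | succ n ih => rw [prod_range_succ, ← mul_assoc, ih, pow_succ 2, pow_mul]; ring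

lemma mul_prod_pow (X : ℝ) (n : ℕ) :
    X * ∏ i ∈ range n, X ^ (2 ^ i) = X ^ (2 ^ n) := by
  induction n with
  | zero => simp
  | succ n ih => rw [prod_range_succ, ← mul_assoc, ih, pow_succ 2, pow_mul]; ring

lemma mul_prod_le_F_add_one (D : ℝ) (hD : 0 < D) (n : ℕ) (m : ℕ → ℝ)
    (hm : ∀ i < n + 1, 1 < m i) (hmono : ∀ i, i + 1 < n + 1 → m i ≤ m (i + 1))
    (htail : ∀ j < n + 1, (D * ∏ i ∈ range j, m i + 1) / (D * ∏ i ∈ range j, m i) ≤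
      ∏ i ∈ Ico j (n + 1), m i / (m i - 1)) :
    D * ∏ i ∈ range (n + 1), m i ≤ F (n + 1) (D + 1) := by
  set X := D + 1 with hX
  have hX1 : 1 < X := by linarith
  have hXp : ∀ i, 1 < X ^ (2 ^ i) := fun i => one_lt_pow₀ hX1 (by positivity)
  set y : ℕ → ℝ := fun i => if i = n then X ^ (2 ^ n) else X ^ (2 ^ i) + 1 with hy
  have hy1 : ∀ i, 1 < y i := by
    intro i
    simp only [hy]
    split_ifs
    · exact hXp n
    · linarith [hXp i]
  have hyr : ∀ j ≤ n, D * ∏ i ∈ range j, y i = X ^ (2 ^ j) - 1 := by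
    intro j hj
    rw [← mul_prod_pow_add_one, show X - 1 = D by linarith]
    congr 1
    refine prod_congr rfl fun i hi => ?_
    simp only [mem_range] at hi
    simp only [hy, if_neg (show i ≠ n by omega)]
  have hyn : D * ∏ i ∈ range (n + 1), y i = F (n + 1) X := by
    rw [prod_range_succ, ← mul_assoc, hyr n le_rfl, F_succ]
    simp only [hy, if_true]
    ring
  rw [← hyn]
  refine mul_le_mul_of_nonneg_left ?_ hD.le
  refine prod_le_prod_of_tail (n + 1) m y (fun t => 1 / (t - 1)) (fun t => t / (t - 1))
    (fun i hi => by linarith [hm i hi]) (fun i _ => by linarith [hy1 i])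
    (fun i hi => div_pos (by linarith [hm i hi]) (by linarith [hm i hi]))
    (fun i _ => div_pos (by linarith [hy1 i]) (by linarith [hy1 i]))
    (fun i hi => one_div_le_one_div_of_le (by linarith [hm i (by omega)])
      (by linarith [hmono i hi]))
    (fun i hi => one_div_pos.2 (by linarith [hm i hi])) ?_ ?_
  · intro i hi
    have h1 := hm i hi
    have h2 := hy1 i
    have h := mul_log_sub_log_le (a := m i - 1) (b := y i - 1) (by linarith) (by linarith)
    simp only [sub_add_cancel] at h
    rw [Real.log_div (by linarith) (by linarith), Real.log_div (by linarith) (by linarith),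
      one_div, ← div_eq_inv_mul, le_div_iff₀ (by linarith)]
    linarith
  · intro j hj hle
    refine le_trans ?_ (htail j hj)
    have hyt : ∏ i ∈ Ico j (n + 1), y i / (y i - 1) = X ^ (2 ^ j) / (X ^ (2 ^ j) - 1) := by
      rw [← prod_Ico_one_add_inv_pow X hX1 n j (by omega), prod_Ico_succ_top (by omega)]
      congr 1
      · refine prod_congr rfl fun i hi => ?_
        simp only [mem_Ico] at hi
        simp only [hy, if_neg (show i ≠ n by omega), add_sub_cancel_right]
      · simp only [hy, if_true]
    rw [hyt]
    have hmp : 0 < ∏ i ∈ range j, m i :=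
      prod_pos fun i hi => by simp at hi; linarith [hm i (by omega)]
    have h1 := mul_le_mul_of_nonneg_left hle hD.le
    rw [hyr j (by omega)] at h1
    have h0 := mul_pos hD hmp
    rw [div_le_div_iff₀ (by linarith [hXp j]) h0]
    nlinarith

lemma mul_prod_le_F (D : ℝ) (hD : 1 < D) (n : ℕ) (m : ℕ → ℝ)
    (hm : ∀ i < n + 1, 0 < m i) (hmono : ∀ i, i + 1 < n + 1 → m i ≤ m (i + 1))
    (hgt : ∀ j < n + 1, 1 < D * ∏ i ∈ range j, m i)
    (htail : ∀ j < n + 1, (D * ∏ i ∈ range j, m i) / (D * ∏ i ∈ range j, m i - 1) ≤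
      ∏ i ∈ Ico j (n + 1), (m i + 1) / m i) :
    D * ∏ i ∈ range (n + 1), m i ≤ F (n + 1) D := by
  have hDp : ∀ i, 1 < D ^ (2 ^ i) := fun i => one_lt_pow₀ hD (by positivity)
  set y : ℕ → ℝ := fun i => if i = n then D ^ (2 ^ n) - 1 else D ^ (2 ^ i) with hy
  have hy1 : ∀ i, 0 < y i := by
    intro i
    simp only [hy]
    split_ifs
    · linarith [hDp n]
    · linarith [hDp i]
  have hyr : ∀ j ≤ n, D * ∏ i ∈ range j, y i = D ^ (2 ^ j) := by
    intro j hj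
    rw [← mul_prod_pow]
    congr 1
    refine prod_congr rfl fun i hi => ?_
    simp only [mem_range] at hi
    simp only [hy, if_neg (show i ≠ n by omega)]
  have hyn : D * ∏ i ∈ range (n + 1), y i = F (n + 1) D := by
    rw [prod_range_succ, ← mul_assoc, hyr n le_rfl, F_succ]
    simp only [hy, if_true]
  rw [← hyn]
  refine mul_le_mul_of_nonneg_left ?_ (by linarith)
  refine prod_le_prod_of_tail (n + 1) m y (fun t => 1 / (t + 1)) (fun t => (t + 1) / t)
    hm (fun i _ => hy1 i)
    (fun i hi => div_pos (by linarith [hm i hi]) (hm i hi))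
    (fun i _ => div_pos (by linarith [hy1 i]) (hy1 i))
    (fun i hi => one_div_le_one_div_of_le (by linarith [hm i (by omega)])
      (by linarith [hmono i hi]))
    (fun i hi => one_div_pos.2 (by linarith [hm i hi])) ?_ ?_
  · intro i hi
    have h1 := hm i hi
    have h2 := hy1 i
    have h := mul_log_sub_log_le h1 h2
    rw [Real.log_div (by linarith) (by linarith), Real.log_div (by linarith) (by linarith),
      one_div, ← div_eq_inv_mul, le_div_iff₀ (by linarith)]
    linarith
  · intro j hj hle
    refine le_trans ?_ (htail j hj)
    have hyt : ∏ i ∈ Ico j (n + 1), (y i + 1) / y i = D ^ (2 ^ j) / (D ^ (2 ^ j) - 1) := by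
      rw [← prod_Ico_one_add_inv_pow D hD n j (by omega), prod_Ico_succ_top (by omega)]
      congr 1
      · refine prod_congr rfl fun i hi => ?_
        simp only [mem_Ico] at hi
        simp only [hy, if_neg (show i ≠ n by omega)]
      · simp only [hy, if_true, sub_add_cancel]
    rw [hyt]
    have h1 := mul_le_mul_of_nonneg_left hle (by linarith : (0 : ℝ) ≤ D)
    rw [hyr j (by omega)] at h1
    have h0 := hgt j hj
    rw [div_le_div_iff₀ (by linarith [hDp j]) (by linarith)]
    nlinarith

lemma exists_monotone_enumeration (C : Finset ℕ) (key : ℕ → ℕ) :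
    ∃ σ : ℕ → ℕ, Set.InjOn σ (range (#C)) ∧ (range (#C)).image σ = C ∧
      ∀ i, i + 1 < #C → key (σ i) ≤ key (σ (i + 1)) := by
  induction C using Finset.induction_on_max_value key with
  | empty => exact ⟨id, by simp⟩
  | insert a s ha hmax ih =>
    obtain ⟨σ, hinj, him, hmono⟩ := ih
    have hmem : ∀ i < #s, σ i ∈ s := fun i hi => by
      rw [← him]; exact mem_image_of_mem _ (mem_range.2 hi)
    refine ⟨fun i => if i < #s then σ i else a, ?_, ?_, ?_⟩
    · intro i hi j hj hij
      rw [card_insert_of_notMem ha] at hi hj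
      simp only [coe_range, Set.mem_Iio] at hi hj
      by_cases h1 : i < #s <;> by_cases h2 : j < #s <;> simp only [h1, h2, if_true, if_false] at hij
      · exact hinj (by simpa using h1) (by simpa using h2) hij
      · exact absurd (hij ▸ hmem i h1) ha
      · exact absurd (hij ▸ hmem j h2) ha
      · omega
    · rw [card_insert_of_notMem ha, range_add_one, image_insert, if_neg (lt_irrefl _)]
      congr 1
      conv_rhs => rw [← him]
      refine image_congr fun i hi => ?_
      simp only [coe_range, Set.mem_Iio] at hi
      simp [hi]
    · intro i hi
      rw [card_insert_of_notMem ha] at hi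
      simp only [show i < #s by omega, if_true]
      split_ifs with h
      · exact hmono i h
      · exact hmax _ (hmem i (by omega))

/-- If a chain of values of `h` along a sorted enumeration of `C` crosses `1`, stop at the first
crossing. -/
lemma exists_first_crossing (C : Finset ℕ) (key : ℕ → ℕ) (Q : Finset ℕ → Prop)
    (h0 : ¬ Q ∅) (hC : Q C) :
    ∃ (n : ℕ) (σ : ℕ → ℕ), (∀ i < n + 1, σ i ∈ C) ∧
      Set.InjOn σ (range (n + 1)) ∧ (∀ i, i + 1 < n + 1 → key (σ i) ≤ key (σ (i + 1))) ∧
      Q ((range (n + 1)).image σ) ∧ ∀ j < n + 1, ¬ Q ((range j).image σ) := by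
  classical
  obtain ⟨σ, hinj, him, hmono⟩ := exists_monotone_enumeration C key
  have hex : ∃ r, Q ((range r).image σ) := ⟨#C, by rwa [him]⟩
  have hle : Nat.find hex ≤ #C := Nat.find_min' hex (by rwa [him])
  obtain ⟨n, hn⟩ : ∃ n, Nat.find hex = n + 1 := by
    refine Nat.exists_eq_succ_of_ne_zero fun h => h0 ?_
    have := Nat.find_spec hex
    rw [h] at this
    simpa using this
  refine ⟨n, σ, ?_, ?_, ?_, hn ▸ Nat.find_spec hex, fun j hj => Nat.find_min hex (hn ▸ hj)⟩
  · intro i hi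
    rw [← him]
    exact mem_image_of_mem _ (mem_range.2 (by omega))
  · exact hinj.mono (by simp; omega)
  · exact fun i hi => hmono i (by omega)

lemma exists_subset_mul_prod_le_F_add_one (C : Finset ℕ) (key : ℕ → ℕ) (D : ℕ) (hD : 0 < D)
    (h : Finset ℕ → ℝ) (hkey : ∀ p ∈ C, 1 < key p) (h0 : 1 < h ∅) (hC : h C ≤ 1)
    (hins : ∀ T ⊆ C, ∀ p ∈ C, p ∉ T → h T * (1 - 1 / (key p : ℝ)) ≤ h (insert p T))
    (hint : ∀ T ⊆ C, ∃ z : ℤ, h T * (D * ∏ p ∈ T, (key p : ℝ)) = z) :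
    ∃ T ⊆ C, T.Nonempty ∧ D * ∏ p ∈ T, (key p : ℝ) ≤ F (#T) (D + 1) := by
  obtain ⟨n, σ, hσ, hinj, hmono, hQ, hnQ⟩ :=
    exists_first_crossing C key (fun T => h T ≤ 1) (by simpa using h0) hC
  have hsub : ∀ j ≤ n + 1, (range j).image σ ⊆ C := fun j hj =>
    image_subset_iff.2 fun i hi => hσ i (by simp at hi; omega)
  have hk : ∀ i < n + 1, (1 : ℝ) < key (σ i) := fun i hi => by exact_mod_cast hkey _ (hσ i hi)
  have hprod : ∀ j ≤ n + 1, ∏ p ∈ (range j).image σ, (key p : ℝ) =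
      ∏ i ∈ range j, (key (σ i) : ℝ) := fun j hj =>
    prod_image (hinj.mono (by simp; omega))
  have hD' : (0 : ℝ) < D := by exact_mod_cast hD
  refine ⟨(range (n + 1)).image σ, hsub _ le_rfl, by simp, ?_⟩
  rw [hprod _ le_rfl, card_image_of_injOn hinj, card_range]
  refine mul_prod_le_F_add_one D hD' n (fun i => key (σ i)) hk
    (fun i hi => by exact_mod_cast hmono i hi) fun j hj => ?_
  have hpp : 0 < (D : ℝ) * ∏ i ∈ range j, (key (σ i) : ℝ) :=
    mul_pos hD' (prod_pos fun i hi => by simp at hi; linarith [hk i (by omega)])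
  have hlow : ((D : ℝ) * ∏ i ∈ range j, (key (σ i) : ℝ) + 1) / (D * ∏ i ∈ range j, (key (σ i) : ℝ))
      ≤ h ((range j).image σ) := by
    obtain ⟨z, hz⟩ := hint _ (hsub j hj.le)
    rw [hprod j hj.le] at hz
    rw [div_le_iff₀ hpp, hz]
    have h1 := mul_lt_mul_of_pos_right (not_le.1 (hnQ j hj)) hpp
    rw [hz, one_mul] at h1
    have h2 : ((D * ∏ i ∈ range j, key (σ i) : ℕ) : ℤ) + 1 ≤ z := by
      have : ((D * ∏ i ∈ range j, key (σ i) : ℕ) : ℝ) < (z : ℝ) := by push_cast; exact h1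
      have : ((D * ∏ i ∈ range j, key (σ i) : ℕ) : ℤ) < z := by exact_mod_cast this
      omega
    have h3 : (((D * ∏ i ∈ range j, key (σ i) : ℕ) : ℤ) : ℝ) + 1 ≤ z := by exact_mod_cast h2
    push_cast at h3
    exact h3
  have hchain : ∀ r, j ≤ r → r ≤ n + 1 → h ((range j).image σ) ≤
      h ((range r).image σ) * ∏ i ∈ Ico j r, (key (σ i) : ℝ) / (key (σ i) - 1) := by
    intro r hr
    induction r, hr using Nat.le_induction with
    | base => simp
    | succ r hjr ih =>
      intro hrn
      refine (ih (by omega)).trans ?_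
      have hki := hk r (by omega)
      have hnot : σ r ∉ (range r).image σ := by
        intro hmem
        obtain ⟨i, hi, hir⟩ := mem_image.1 hmem
        rw [mem_range] at hi
        exact hi.ne (hinj (by simp; omega) (by simp; omega) hir)
      have h1 := hins _ (hsub r (by omega)) _ (hσ r (by omega)) hnot
      rw [prod_Ico_succ_top hjr, range_add_one, image_insert, mul_comm (∏ i ∈ Ico j r, _),
        ← mul_assoc]
      refine mul_le_mul_of_nonneg_right ?_ (prod_nonneg fun i hi => ?_)
      · rw [mul_div_assoc', le_div_iff₀ (by linarith)]
        have h2 := mul_le_mul_of_nonneg_right h1 (by linarith : (0 : ℝ) ≤ key (σ r))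
        calc _ = h ((range r).image σ) * (1 - 1 / (key (σ r) : ℝ)) * key (σ r) := by
              field_simp
          _ ≤ _ := h2
      · simp only [mem_Ico] at hi
        have := hk i (by omega)
        exact div_nonneg (by linarith) (by linarith)
  refine hlow.trans ((hchain (n + 1) hj.le le_rfl).trans ?_)
  refine mul_le_of_le_one_left (prod_nonneg fun i hi => ?_) hQ
  simp only [mem_Ico] at hi
  have := hk i (by omega)
  exact div_nonneg (by linarith) (by linarith)

lemma exists_subset_mul_prod_le_F (C : Finset ℕ) (key : ℕ → ℕ) (D : ℕ) (hD : 0 < D)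
    (h : Finset ℕ → ℝ) (hkey : ∀ p ∈ C, 0 < key p) (h0 : h ∅ < 1) (hC : 1 ≤ h C)
    (hpos : ∀ T ⊆ C, 0 < h T)
    (hins : ∀ T ⊆ C, ∀ p ∈ C, p ∉ T → h (insert p T) ≤ h T * (((key p : ℝ) + 1) / key p))
    (hint : ∀ T ⊆ C, ∃ z : ℤ, h T * (D * ∏ p ∈ T, (key p : ℝ)) = z) :
    ∃ T ⊆ C, T.Nonempty ∧ 1 ≤ h T ∧ D * ∏ p ∈ T, (key p : ℝ) ≤ F (#T) D := by
  obtain ⟨n, σ, hσ, hinj, hmono, hQ, hnQ⟩ :=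
    exists_first_crossing C key (fun T => 1 ≤ h T) (by simpa using h0) hC
  have hsub : ∀ j ≤ n + 1, (range j).image σ ⊆ C := fun j hj =>
    image_subset_iff.2 fun i hi => hσ i (by simp at hi; omega)
  have hk : ∀ i < n + 1, (0 : ℝ) < key (σ i) := fun i hi => by exact_mod_cast hkey _ (hσ i hi)
  have hprod : ∀ j ≤ n + 1, ∏ p ∈ (range j).image σ, (key p : ℝ) =
      ∏ i ∈ range j, (key (σ i) : ℝ) := fun j hj =>
    prod_image (hinj.mono (by simp; omega))
  have hD' : (0 : ℝ) < D := by exact_mod_cast hD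
  have hpp : ∀ j < n + 1, 0 < (D : ℝ) * ∏ i ∈ range j, (key (σ i) : ℝ) := fun j hj =>
    mul_pos hD' (prod_pos fun i hi => by simp at hi; linarith [hk i (by omega)])
  have hup : ∀ j < n + 1, h ((range j).image σ) * (D * ∏ i ∈ range j, (key (σ i) : ℝ)) ≤
      D * ∏ i ∈ range j, (key (σ i) : ℝ) - 1 := by
    intro j hj
    obtain ⟨z, hz⟩ := hint _ (hsub j hj.le)
    rw [hprod j hj.le] at hz
    rw [hz]
    have h1 := mul_lt_mul_of_pos_right (not_le.1 (hnQ j hj)) (hpp j hj)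
    rw [hz, one_mul] at h1
    have h2 : z ≤ ((D * ∏ i ∈ range j, key (σ i) : ℕ) : ℤ) - 1 := by
      have : (z : ℝ) < ((D * ∏ i ∈ range j, key (σ i) : ℕ) : ℝ) := by push_cast; exact h1
      have : z < ((D * ∏ i ∈ range j, key (σ i) : ℕ) : ℤ) := by exact_mod_cast this
      omega
    have h3 : (z : ℝ) ≤ (((D * ∏ i ∈ range j, key (σ i) : ℕ) : ℤ) : ℝ) - 1 := by exact_mod_cast h2
    push_cast at h3
    exact h3
  have hgt : ∀ j < n + 1, 1 < D * ∏ i ∈ range j, (key (σ i) : ℝ) := by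
    intro j hj
    have := mul_pos (hpos _ (hsub j hj.le)) (hpp j hj)
    linarith [hup j hj]
  refine ⟨(range (n + 1)).image σ, hsub _ le_rfl, by simp, hQ, ?_⟩
  rw [hprod _ le_rfl, card_image_of_injOn hinj, card_range]
  refine mul_prod_le_F D (by simpa using hgt 0 (by omega)) n (fun i => key (σ i)) hk
    (fun i hi => by exact_mod_cast hmono i hi) hgt fun j hj => ?_
  have hchain : ∀ r, j ≤ r → r ≤ n + 1 → h ((range r).image σ) ≤
      h ((range j).image σ) * ∏ i ∈ Ico j r, ((key (σ i) : ℝ) + 1) / key (σ i) := by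
    intro r hr
    induction r, hr using Nat.le_induction with
    | base => simp
    | succ r hjr ih =>
      intro hrn
      have hki := hk r (by omega)
      have hnot : σ r ∉ (range r).image σ := by
        intro hmem
        obtain ⟨i, hi, hir⟩ := mem_image.1 hmem
        rw [mem_range] at hi
        exact hi.ne (hinj (by simp; omega) (by simp; omega) hir)
      have h1 := hins _ (hsub r (by omega)) _ (hσ r (by omega)) hnot
      rw [prod_Ico_succ_top hjr, range_add_one, image_insert, ← mul_assoc]
      exact h1.trans (mul_le_mul_of_nonneg_right (ih (by omega)) (by positivity))
  have h1 := hQ.trans (hchain (n + 1) hj.le le_rfl)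
  have hpr : 0 ≤ ∏ i ∈ Ico j (n + 1), ((key (σ i) : ℝ) + 1) / key (σ i) :=
    prod_nonneg fun i _ => by positivity
  rw [div_le_iff₀ (by linarith [hgt j hj])]
  calc (D : ℝ) * ∏ i ∈ range j, (key (σ i) : ℝ)
      ≤ (D * ∏ i ∈ range j, (key (σ i) : ℝ)) * (h ((range j).image σ) *
          ∏ i ∈ Ico j (n + 1), ((key (σ i) : ℝ) + 1) / key (σ i)) :=
        le_mul_of_one_le_right (hpp j hj).le h1
    _ = (∏ i ∈ Ico j (n + 1), ((key (σ i) : ℝ) + 1) / key (σ i)) *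
          (h ((range j).image σ) * (D * ∏ i ∈ range j, (key (σ i) : ℝ))) := by ring
    _ ≤ _ := mul_le_mul_of_nonneg_left (hup j hj) hpr

/-- The weight `(1 - 1/p) / (1 - 1/q)`, in which the first factor is kept only for `p ∈ S` and
the second only for `p ∈ A`. -/
noncomputable def weight (q : ℕ → ℕ) (A S : Finset ℕ) (p : ℕ) : ℝ :=
  (if p ∈ S then 1 - 1 / (p : ℝ) else 1) * (if p ∈ A then (q p : ℝ) / (q p - 1) else 1)

noncomputable def weightSum {ι : Type*} [Fintype ι] (Q : ι → Finset ℕ) (q : ℕ → ℕ)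
    (A S : Finset ℕ) : ℝ :=
  ∑ i, ∏ p ∈ Q i, weight q A S p

/-- A common denominator of `weightSum Q q A S`. -/
def commonDenom (q : ℕ → ℕ) (A S : Finset ℕ) : ℕ := (∏ p ∈ A, (q p - 1)) * ∏ p ∈ S, p

lemma one_sub_inv_pos {p : ℕ} (hp : 2 ≤ p) : 0 < 1 - 1 / (p : ℝ) := by
  have : (2 : ℝ) ≤ p := by exact_mod_cast hp
  rw [sub_pos, div_lt_one (by linarith)]
  linarith

lemma one_sub_inv_lt_one {p : ℕ} (hp : 2 ≤ p) : 1 - 1 / (p : ℝ) < 1 := by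
  have : (2 : ℝ) ≤ p := by exact_mod_cast hp
  have : 0 < 1 / (p : ℝ) := by positivity
  linarith

lemma one_lt_div_sub_one {q : ℕ} (hq : 2 ≤ q) : 1 < (q : ℝ) / (q - 1) := by
  have : (2 : ℝ) ≤ q := by exact_mod_cast hq
  rw [one_lt_div (by linarith)]
  linarith

lemma one_sub_inv_mul_lt_one {p q : ℕ} (hp : 2 ≤ p) (hpq : p < q) :
    (1 - 1 / (p : ℝ)) * ((q : ℝ) / (q - 1)) < 1 := by
  have h1 : (2 : ℝ) ≤ p := by exact_mod_cast hp
  have h2 : (p : ℝ) < q := by exact_mod_cast hpq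
  rw [mul_div_assoc', div_lt_one (by linarith), sub_mul, one_mul, sub_lt_sub_iff_left,
    div_mul_eq_mul_div, one_mul, one_lt_div (by linarith)]
  exact h2

lemma weight_pos {q : ℕ → ℕ} (A S : Finset ℕ) {p : ℕ} (hp : 2 ≤ p) (hpq : p < q p) :
    0 < weight q A S p := by
  have h1 := one_sub_inv_pos hp
  have h2 := one_lt_div_sub_one (q := q p) (by omega)
  unfold weight
  split_ifs <;> nlinarith

lemma weight_mono_left {q : ℕ → ℕ} {A A' S : Finset ℕ} {p : ℕ} (hp : 2 ≤ p) (hpq : p < q p)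
    (hA : A ⊆ A') : weight q A S p ≤ weight q A' S p := by
  have h1 := one_sub_inv_pos hp
  have h2 := one_lt_div_sub_one (q := q p) (by omega)
  have h3 := @hA p
  unfold weight
  split_ifs <;> first | nlinarith | tauto

lemma weight_self_anti {q : ℕ → ℕ} {S S' : Finset ℕ} {p : ℕ} (hp : 2 ≤ p) (hpq : p < q p)
    (hS : S ⊆ S') : weight q S' S' p ≤ weight q S S p := by
  have h1 := one_sub_inv_mul_lt_one hp hpq
  have h3 := @hS p
  unfold weight
  split_ifs <;> first | nlinarith | tauto

lemma weightSum_le {ι : Type*} [Fintype ι] {Q : ι → Finset ℕ} {q : ℕ → ℕ} {A S A' S' : Finset ℕ}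
    (hQ : ∀ i, ∀ p ∈ Q i, 2 ≤ p ∧ p < q p)
    (hle : ∀ i, ∀ p ∈ Q i, weight q A S p ≤ weight q A' S' p) :
    weightSum Q q A S ≤ weightSum Q q A' S' :=
  sum_le_sum fun i _ => prod_le_prod
    (fun p hp => (weight_pos _ _ (hQ i p hp).1 (hQ i p hp).2).le) (hle i)

lemma weightSum_lt {ι : Type*} [Fintype ι] {Q : ι → Finset ℕ} {q : ℕ → ℕ} {A S A' S' : Finset ℕ}
    (hQ : ∀ i, ∀ p ∈ Q i, 2 ≤ p ∧ p < q p)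
    (hle : ∀ i, ∀ p ∈ Q i, weight q A S p ≤ weight q A' S' p)
    (hlt : ∃ i, ∃ p ∈ Q i, weight q A S p < weight q A' S' p) :
    weightSum Q q A S < weightSum Q q A' S' := by
  obtain ⟨i, p, hp, h⟩ := hlt
  refine sum_lt_sum (fun i _ => prod_le_prod
    (fun p hp => (weight_pos _ _ (hQ i p hp).1 (hQ i p hp).2).le) (hle i)) ⟨i, mem_univ i, ?_⟩
  exact prod_lt_prod (fun p hp => weight_pos _ _ (hQ i p hp).1 (hQ i p hp).2) (hle i) ⟨p, hp, h⟩

lemma prod_weight (q : ℕ → ℕ) (A S R : Finset ℕ) :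
    ∏ p ∈ R, weight q A S p =
      (∏ p ∈ R ∩ S, (1 - 1 / (p : ℝ))) * ∏ p ∈ R ∩ A, (q p : ℝ) / (q p - 1) := by
  simp only [weight, prod_mul_distrib, prod_ite_mem]

lemma weightSum_pos {ι : Type*} [Fintype ι] [Nonempty ι] {Q : ι → Finset ℕ} {q : ℕ → ℕ}
    (A S : Finset ℕ) (hQ : ∀ i, ∀ p ∈ Q i, 2 ≤ p ∧ p < q p) : 0 < weightSum Q q A S :=
  sum_pos (fun i _ => prod_pos fun p hp => weight_pos _ _ (hQ i p hp).1 (hQ i p hp).2)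
    univ_nonempty

lemma weightSum_mul_le_insert {ι : Type*} [Fintype ι] {Q : ι → Finset ℕ} {q : ℕ → ℕ}
    (A S : Finset ℕ) (hQ : ∀ i, ∀ p ∈ Q i, 2 ≤ p ∧ p < q p) {p : ℕ} (hp : 2 ≤ p) (hpS : p ∉ S) :
    weightSum Q q A S * (1 - 1 / (p : ℝ)) ≤ weightSum Q q A (insert p S) := by
  rw [weightSum, sum_mul]
  refine sum_le_sum fun i _ => ?_
  have hpos : 0 < ∏ p ∈ Q i, weight q A S p :=
    prod_pos fun p hp => weight_pos _ _ (hQ i p hp).1 (hQ i p hp).2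
  rw [prod_weight] at hpos ⊢
  rw [prod_weight]
  by_cases h : p ∈ Q i
  · rw [inter_insert_of_mem h, prod_insert (by simp [hpS])]
    exact le_of_eq (by ring)
  · rw [inter_insert_of_notMem h]
    exact mul_le_of_le_one_right hpos.le (one_sub_inv_lt_one hp).le

lemma weightSum_insert_le_mul {ι : Type*} [Fintype ι] {Q : ι → Finset ℕ} {q : ℕ → ℕ}
    (A S : Finset ℕ) (hQ : ∀ i, ∀ p ∈ Q i, 2 ≤ p ∧ p < q p) {p : ℕ} (hp : 2 ≤ q p) (hpA : p ∉ A) :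
    weightSum Q q (insert p A) S ≤ weightSum Q q A S * ((q p : ℝ) / (q p - 1)) := by
  rw [weightSum, weightSum, sum_mul]
  refine sum_le_sum fun i _ => ?_
  have hpos : 0 < ∏ p ∈ Q i, weight q A S p :=
    prod_pos fun p hp => weight_pos _ _ (hQ i p hp).1 (hQ i p hp).2
  rw [prod_weight] at hpos
  rw [prod_weight, prod_weight]
  by_cases h : p ∈ Q i
  · rw [inter_insert_of_mem h, prod_insert (by simp [hpA])]
    exact le_of_eq (by ring)
  · rw [inter_insert_of_notMem h]
    exact le_mul_of_one_le_right hpos.le (one_lt_div_sub_one hp).le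

lemma exists_prod_inter_div_mul_eq (R S : Finset ℕ) (a b : ℕ → ℕ) (hb : ∀ p ∈ S, 0 < b p) :
    ∃ z : ℕ, (∏ p ∈ R ∩ S, (a p : ℝ) / b p) * ∏ p ∈ S, (b p : ℝ) = z := by
  refine ⟨(∏ p ∈ R ∩ S, a p) * ∏ p ∈ S \ R, b p, ?_⟩
  rw [← prod_inter_mul_prod_sdiff S R, inter_comm S R, ← mul_assoc, ← prod_mul_distrib]
  push_cast
  congr 1
  refine prod_congr rfl fun p hp => ?_
  have := hb p (mem_inter.1 hp).2
  field_simp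

lemma exists_weightSum_mul_commonDenom {ι : Type*} [Fintype ι] (Q : ι → Finset ℕ) {q : ℕ → ℕ}
    (A S : Finset ℕ) (hA : ∀ p ∈ A, 2 ≤ q p) (hS : ∀ p ∈ S, 2 ≤ p) :
    ∃ z : ℤ, weightSum Q q A S * commonDenom q A S = z := by
  have hterm : ∀ i, ∃ z : ℕ, (∏ p ∈ Q i, weight q A S p) * commonDenom q A S = z := by
    intro i
    obtain ⟨z₁, h₁⟩ := exists_prod_inter_div_mul_eq (Q i) S (fun p => p - 1) (fun p => p)
      (fun p hp => by have := hS p hp; omega)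
    obtain ⟨z₂, h₂⟩ := exists_prod_inter_div_mul_eq (Q i) A q (fun p => q p - 1)
      (fun p hp => by have := hA p hp; omega)
    refine ⟨z₁ * z₂, ?_⟩
    rw [prod_weight, commonDenom]
    push_cast
    rw [← h₁, ← h₂]
    have e1 : ∏ p ∈ Q i ∩ S, (1 - 1 / (p : ℝ)) = ∏ p ∈ Q i ∩ S, ((p - 1 : ℕ) : ℝ) / p := by
      refine prod_congr rfl fun p hp => ?_
      have := hS p (mem_inter.1 hp).2
      rw [Nat.cast_sub (by omega), Nat.cast_one]
      field_simp
    have e2 : ∏ p ∈ Q i ∩ A, (q p : ℝ) / (q p - 1) =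
        ∏ p ∈ Q i ∩ A, (q p : ℝ) / ((q p - 1 : ℕ) : ℝ) := by
      refine prod_congr rfl fun p hp => ?_
      have := hA p (mem_inter.1 hp).2
      rw [Nat.cast_sub (by omega), Nat.cast_one]
    rw [e1, e2]
    ring
  choose z hz using hterm
  refine ⟨∑ i, (z i : ℤ), ?_⟩
  rw [weightSum, sum_mul]
  push_cast
  exact sum_congr rfl fun i _ => hz i

lemma commonDenom_pos {q : ℕ → ℕ} {A S : Finset ℕ} (hA : ∀ p ∈ A, 2 ≤ q p)
    (hS : ∀ p ∈ S, 2 ≤ p) : 0 < commonDenom q A S :=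
  Nat.mul_pos (prod_pos fun p hp => by have := hA p hp; omega)
    (prod_pos fun p hp => by have := hS p hp; omega)

lemma commonDenom_union_right (q : ℕ → ℕ) {A S T : Finset ℕ} (h : Disjoint S T) :
    commonDenom q A (S ∪ T) = commonDenom q A S * ∏ p ∈ T, p := by
  rw [commonDenom, prod_union h, commonDenom, mul_assoc]

lemma commonDenom_union_left (q : ℕ → ℕ) {A S T : Finset ℕ} (h : Disjoint A T) :
    commonDenom q (A ∪ T) S = commonDenom q A S * ∏ p ∈ T, (q p - 1) := by
  rw [commonDenom, prod_union h, commonDenom]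
  ring

/-- If the weighted sum drops below `1`, some of the powers `q p` can be bounded. -/
lemma exists_commonDenom_union_left_le {ι : Type*} [Fintype ι] [Nonempty ι] {Q : ι → Finset ℕ}
    {q : ℕ → ℕ} {A S : Finset ℕ} (hQ : ∀ i, ∀ p ∈ Q i, 2 ≤ p ∧ p < q p)
    (hS : ∀ p ∈ S, 2 ≤ p ∧ p < q p) (hAS : A ⊆ S)
    (hlt : weightSum Q q A S < 1) (hle : 1 ≤ weightSum Q q S S) :
    ∃ T ⊆ S \ A, T.Nonempty ∧ 1 ≤ weightSum Q q (A ∪ T) S ∧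
      (commonDenom q (A ∪ T) S : ℝ) ≤ F (#T) (commonDenom q A S) := by
  have hS2 : ∀ p ∈ S, 2 ≤ q p := fun p hp => by have := hS p hp; omega
  have hcast : ∀ T ⊆ S \ A, (commonDenom q (A ∪ T) S : ℝ) =
      commonDenom q A S * ∏ p ∈ T, ((q p - 1 : ℕ) : ℝ) := by
    intro T hT
    rw [commonDenom_union_left q (disjoint_of_subset_right hT disjoint_sdiff)]
    push_cast
    rfl
  obtain ⟨T, hT, hne, h1, h2⟩ := exists_subset_mul_prod_le_F (S \ A) (fun p => q p - 1)
    (commonDenom q A S)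
    (commonDenom_pos (fun p hp => hS2 p (hAS hp)) fun p hp => (hS p hp).1)
    (fun T => weightSum Q q (A ∪ T) S)
    (fun p hp => by have := hS2 p (mem_sdiff.1 hp).1; omega)
    (by simpa using hlt) (by rwa [union_sdiff_of_subset hAS])
    (fun T _ => weightSum_pos _ _ hQ)
    (fun T hT p hp hpT => by
      have hp2 := hS2 p (mem_sdiff.1 hp).1
      rw [union_insert]
      refine (weightSum_insert_le_mul _ _ hQ hp2 ?_).trans (le_of_eq ?_)
      · simp [hpT, (mem_sdiff.1 hp).2]
      · rw [Nat.cast_sub (by omega), Nat.cast_one, sub_add_cancel])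
    (fun T hT => by
      rw [← hcast T hT]
      refine exists_weightSum_mul_commonDenom Q _ _ (fun p hp => ?_) fun p hp => (hS p hp).1
      rcases mem_union.1 hp with h | h
      · exact hS2 p (hAS h)
      · exact hS2 p (mem_sdiff.1 (hT h)).1)
  exact ⟨T, hT, hne, h1, by rw [hcast T hT]; exact h2⟩

/-- If the weighted sum exceeds `1`, some further primes `p` can be bounded. -/
lemma exists_commonDenom_union_right_le {ι : Type*} [Fintype ι] {Q : ι → Finset ℕ}
    {q : ℕ → ℕ} {A S P : Finset ℕ} (hQ : ∀ i, ∀ p ∈ Q i, 2 ≤ p ∧ p < q p)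
    (hP : ∀ p ∈ P, 2 ≤ p ∧ p < q p) (hAS : A ⊆ S) (hSP : S ⊆ P)
    (hlt : 1 < weightSum Q q A S) (hle : weightSum Q q A P ≤ 1) :
    ∃ T ⊆ P \ S, T.Nonempty ∧
      (commonDenom q A (S ∪ T) : ℝ) ≤ F (#T) (commonDenom q A S + 1) := by
  have hA2 : ∀ p ∈ A, 2 ≤ q p := fun p hp => by have := hP p (hSP (hAS hp)); omega
  have hcast : ∀ T ⊆ P \ S, (commonDenom q A (S ∪ T) : ℝ) =
      commonDenom q A S * ∏ p ∈ T, (p : ℝ) := by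
    intro T hT
    rw [commonDenom_union_right q (disjoint_of_subset_right hT disjoint_sdiff)]
    push_cast
    rfl
  obtain ⟨T, hT, hne, h2⟩ := exists_subset_mul_prod_le_F_add_one (P \ S) (fun p => p)
    (commonDenom q A S)
    (commonDenom_pos hA2 fun p hp => (hP p (hSP hp)).1)
    (fun T => weightSum Q q A (S ∪ T))
    (fun p hp => (hP p (mem_sdiff.1 hp).1).1)
    (by simpa using hlt) (by rwa [union_sdiff_of_subset hSP])
    (fun T hT p hp hpT => by
      rw [union_insert]
      refine weightSum_mul_le_insert _ _ hQ (hP p (mem_sdiff.1 hp).1).1 ?_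
      simp [hpT, (mem_sdiff.1 hp).2])
    (fun T hT => by
      rw [← hcast T hT]
      refine exists_weightSum_mul_commonDenom Q _ _ hA2 fun p hp => ?_
      rcases mem_union.1 hp with h | h
      · exact (hP p (hSP h)).1
      · exact (hP p (mem_sdiff.1 (hT h)).1).1)
  exact ⟨T, hT, hne, by rw [hcast T hT]; exact h2⟩

lemma commonDenom_le_F_of_le_F {ι : Type*} [Fintype ι] [Nonempty ι] {Q : ι → Finset ℕ}
    {q : ℕ → ℕ} {P : Finset ℕ} (hQP : ∀ i, Q i ⊆ P) (hPQ : ∀ p ∈ P, ∃ i, p ∈ Q i)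
    (hP : ∀ p ∈ P, 2 ≤ p ∧ p < q p) (hone : weightSum Q q P P = 1)
    (hne : ∀ A S, A ⊂ S → S ⊆ P → weightSum Q q A S ≠ 1) (n : ℕ) :
    ∀ A S, A ⊆ S → S ⊆ P → 2 * #P ≤ #A + #S + n →
      (commonDenom q A S : ℝ) ≤ F (#A + #S) 2 → (commonDenom q P P : ℝ) ≤ F (2 * #P) 2 := by
  have hQ : ∀ i, ∀ p ∈ Q i, 2 ≤ p ∧ p < q p := fun i p hp => hP p (hQP i hp)
  have hstep : ∀ {T : Finset ℕ} {m : ℕ} {x : ℝ}, T.Nonempty → 1 ≤ x → x ≤ 2 ^ (2 ^ m) →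
      F (#T) x ≤ F (m + #T) 2 := by
    intro T m x hT h1 hx
    obtain ⟨t, ht⟩ := Nat.exists_eq_succ_of_ne_zero hT.card_pos.ne'
    rw [ht, Nat.succ_eq_add_one, ← F_succ_pow t m 2]
    exact F_succ_mono t h1 hx
  induction n with
  | zero =>
    intro A S hAS hSP hcard hD
    have h1 := card_le_card hAS
    have h2 := card_le_card hSP
    have hS : S = P := eq_of_subset_of_card_le hSP (by omega)
    have hA : A = P := eq_of_subset_of_card_le (hAS.trans hSP) (by omega)
    subst hA
    subst hS
    rwa [two_mul]
  | succ n ih =>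
    intro A S hAS hSP hcard hD
    have hF := F_add_one_le (#A + #S) (x := 2) (by norm_num)
    have hpos : (1 : ℝ) ≤ commonDenom q A S := by
      exact_mod_cast commonDenom_pos (fun p hp => by have := hP p (hSP (hAS hp)); omega)
        fun p hp => (hP p (hSP hp)).1
    rcases lt_trichotomy (weightSum Q q A S) 1 with h | h | h
    · obtain ⟨T, hT, hTne, -, hle⟩ := exists_commonDenom_union_left_le hQ
        (fun p hp => hP p (hSP hp)) hAS h
        (hone ▸ weightSum_le hQ fun i p hp => weight_self_anti (hQ i p hp).1 (hQ i p hp).2 hSP)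
      have hc : #(A ∪ T) = #A + #T :=
        card_union_of_disjoint (disjoint_of_subset_right hT disjoint_sdiff)
      have hTpos := hTne.card_pos
      refine ih (A ∪ T) S (union_subset hAS (hT.trans sdiff_subset)) hSP (by omega) ?_
      rw [hc, show #A + #T + #S = #A + #S + #T by omega]
      exact hle.trans (hstep hTne hpos (by linarith))
    · rcases hAS.eq_or_ssubset with rfl | hss
      · rcases hSP.eq_or_ssubset with rfl | hss
        · rwa [two_mul]
        · obtain ⟨p, hpP, hpA⟩ := exists_of_ssubset hss
          obtain ⟨i, hi⟩ := hPQ p hpP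
          refine absurd h (ne_of_gt ?_)
          rw [← hone]
          refine weightSum_lt hQ
            (fun i p hp => weight_self_anti (hQ i p hp).1 (hQ i p hp).2 hSP) ⟨i, p, hi, ?_⟩
          simpa [weight, hpP, hpA] using one_sub_inv_mul_lt_one (hP p hpP).1 (hP p hpP).2
      · exact absurd h (hne A S hss hSP)
    · obtain ⟨T, hT, hTne, hle⟩ := exists_commonDenom_union_right_le hQ hP hAS hSP h
        (hone ▸ weightSum_le hQ fun i p hp =>
          weight_mono_left (hQ i p hp).1 (hQ i p hp).2 (hAS.trans hSP))
      have hc : #(S ∪ T) = #S + #T :=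
        card_union_of_disjoint (disjoint_of_subset_right hT disjoint_sdiff)
      have hTpos := hTne.card_pos
      refine ih A (S ∪ T) (hAS.trans subset_union_left)
        (union_subset hSP (hT.trans sdiff_subset)) (by omega) ?_
      rw [hc, ← add_assoc]
      exact hle.trans (hstep hTne (by linarith) (by linarith))

lemma F_succ_div_sq_le (r : ℕ) {x y : ℝ} (hx : 1 ≤ x) (hxy : x ≤ y) :
    F (r + 1) x / x ^ 2 ≤ F (r + 1) y / y ^ 2 := by
  have hy : 1 ≤ y := hx.trans hxy
  rw [F_succ, F_succ]
  rcases r with _ | r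
  · rw [div_le_div_iff₀ (by positivity) (by positivity)]
    simp only [pow_zero, pow_one]
    have : 0 ≤ x * y * (y - x) := by
      have : 0 ≤ y - x := by linarith
      positivity
    nlinarith
  · obtain ⟨s, hs⟩ : ∃ s, 2 ^ (r + 1) = s + 2 :=
      ⟨2 ^ (r + 1) - 2, by have := Nat.one_le_two_pow (n := r); rw [pow_succ]; omega⟩
    have hred : ∀ z : ℝ, 1 ≤ z → z ^ (2 ^ (r + 1)) * (z ^ (2 ^ (r + 1)) - 1) / z ^ 2 =
        z ^ s * (z ^ (s + 2) - 1) := by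
      intro z hz
      rw [hs]
      field_simp
      ring
    rw [hred x hx, hred y hy]
    have h1 : x ^ s ≤ y ^ s := pow_le_pow_left₀ (by linarith) hxy _
    have h2 : x ^ (s + 2) ≤ y ^ (s + 2) := pow_le_pow_left₀ (by linarith) hxy _
    have h3 : 1 ≤ x ^ (s + 2) := one_le_pow₀ hx
    exact mul_le_mul h1 (by linarith) (by linarith) (by positivity)

lemma prod_sub_one_div_prod_le {ι : Type*} [Fintype ι] [Nonempty ι] {Q : ι → Finset ℕ}
    {q : ℕ → ℕ} {P : Finset ℕ} (hQP : ∀ i, Q i ⊆ P) (hPQ : ∀ p ∈ P, ∃ i, p ∈ Q i)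
    (hPne : P.Nonempty)
    (hP : ∀ p ∈ P, 2 ≤ p ∧ p < q p) (hone : weightSum Q q P P = 1)
    (hne : ∀ A S, A ⊂ S → S ⊆ P → weightSum Q q A S ≠ 1) :
    ((∏ p ∈ P, (q p - 1) : ℕ) : ℝ) / ((∏ p ∈ P, p : ℕ) : ℝ) ≤
      F (2 * #P) 2 / (2 ^ (2 ^ #P)) ^ 2 := by
  have hQ : ∀ i, ∀ p ∈ Q i, 2 ≤ p ∧ p < q p := fun i p hp => hP p (hQP i hp)
  have hprod : (1 : ℝ) ≤ ((∏ p ∈ P, p : ℕ) : ℝ) := by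
    have : 0 < ∏ p ∈ P, p := prod_pos fun p hp => by have := hP p hp; omega
    exact_mod_cast this
  have hrw : ((∏ p ∈ P, (q p - 1) : ℕ) : ℝ) / ((∏ p ∈ P, p : ℕ) : ℝ) =
      (commonDenom q P P : ℝ) / ((∏ p ∈ P, p : ℕ) : ℝ) ^ 2 := by
    rw [commonDenom, Nat.cast_mul]
    field_simp
  rw [hrw]
  rcases le_total ((2 : ℝ) ^ (2 ^ #P)) ((∏ p ∈ P, p : ℕ) : ℝ) with h | h
  · have hD := commonDenom_le_F_of_le_F hQP hPQ hP hone hne (2 * #P) ∅ ∅ (by simp) (by simp)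
      (by simp) (by norm_num [commonDenom, F])
    exact div_le_div₀ ((Nat.cast_nonneg _).trans hD) hD (by positivity)
      (pow_le_pow_left₀ (by positivity) h 2)
  · obtain ⟨K, hK⟩ := Nat.exists_eq_succ_of_ne_zero hPne.card_pos.ne'
    have hlt : ∀ A, A ⊂ P → weightSum Q q A P < 1 := by
      intro A hA
      obtain ⟨p, hpP, hpA⟩ := exists_of_ssubset hA
      obtain ⟨i, hi⟩ := hPQ p hpP
      rw [← hone]
      refine weightSum_lt hQ
        (fun i p hp => weight_mono_left (hQ i p hp).1 (hQ i p hp).2 hA.1) ⟨i, p, hi, ?_⟩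
      have h1 := one_sub_inv_pos (hP p hpP).1
      have h2 := one_lt_div_sub_one (q := q p) (by have := hP p hpP; omega)
      simp only [weight, hpP, hpA, if_true, if_false]
      exact mul_lt_mul_of_pos_left h2 h1
    obtain ⟨T, hT, -, h1, h2⟩ := exists_commonDenom_union_left_le hQ hP (empty_subset P)
      (hlt ∅ (hPne.empty_ssubset)) hone.ge
    rw [sdiff_empty] at hT
    have hTP : T = P := by
      by_contra hcon
      rw [empty_union] at h1
      exact absurd h1 (not_le.2 (hlt T (hT.ssubset_of_ne hcon)))
    subst hTP
    have hprodD : (commonDenom q ∅ T : ℝ) = ((∏ p ∈ T, p : ℕ) : ℝ) := by simp [commonDenom]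
    rw [empty_union, hprodD, hK, Nat.succ_eq_add_one] at h2
    have h3 := F_succ_div_sq_le K hprod h
    rw [hK, Nat.succ_eq_add_one, F_succ_pow K (K + 1) 2, ← two_mul] at h3
    rw [hK, Nat.succ_eq_add_one]
    exact (div_le_div_of_nonneg_right h2 (by positivity)).trans h3

/-- A sum of fractions in which exactly one denominator is divisible by `p` is not `1`. -/
lemma sum_div_ne_one_of_prime_dvd {ι : Type*} [Fintype ι] {p : ℕ} (hp : p.Prime) (a d : ι → ℕ)
    (hd : ∀ j, 0 < d j) (i : ι) (hdi : p ∣ d i) (hai : ¬ p ∣ a i)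
    (hdj : ∀ j, j ≠ i → ¬ p ∣ d j) : ∑ j, (a j : ℝ) / d j ≠ 1 := by
  classical
  intro h
  have hd' : ∀ j, (d j : ℝ) ≠ 0 := fun j => by exact_mod_cast (hd j).ne'
  have hN : ∑ j, a j * ∏ l ∈ univ.erase j, d l = ∏ l, d l := by
    have : ((∑ j, a j * ∏ l ∈ univ.erase j, d l : ℕ) : ℝ) = ((∏ l, d l : ℕ) : ℝ) := by
      push_cast
      rw [← one_mul (∏ l, (d l : ℝ)), ← h, sum_mul]
      refine sum_congr rfl fun j _ => ?_
      rw [← mul_prod_erase univ (fun l => (d l : ℝ)) (mem_univ j), ← mul_assoc,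
        div_mul_cancel₀ _ (hd' j)]
    exact_mod_cast this
  have hall : p ∣ ∑ j, a j * ∏ l ∈ univ.erase j, d l :=
    hN ▸ hdi.trans (dvd_prod_of_mem d (mem_univ i))
  rw [← add_sum_erase univ _ (mem_univ i), ← Nat.dvd_add_iff_left] at hall
  · rcases hp.dvd_mul.1 hall with h1 | h1
    · exact hai h1
    · obtain ⟨l, hl, hpl⟩ := (hp.prime.dvd_finsetProd_iff _).1 h1
      exact hdj l (ne_of_mem_erase hl) hpl
  · refine dvd_sum fun j hj => Dvd.dvd.mul_left ?_ _
    exact hdi.trans (dvd_prod_of_mem d (mem_erase.2 ⟨(ne_of_mem_erase hj).symm, mem_univ i⟩))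

lemma geom_sum_mul_sub_one (p e : ℕ) :
    ((∑ t ∈ range (e + 1), p ^ t : ℕ) : ℝ) * ((p : ℝ) - 1) = (p : ℝ) ^ (e + 1) - 1 := by
  push_cast
  exact geom_sum_mul _ _

lemma weight_prime_pow {p : ℕ} (hp : 2 ≤ p) (e : ℕ) :
    (1 - 1 / (p : ℝ)) * (((p ^ (e + 1) : ℕ) : ℝ) / (((p ^ (e + 1) : ℕ) : ℝ) - 1)) =
      ((p ^ e : ℕ) : ℝ) / ((∑ t ∈ range (e + 1), p ^ t : ℕ) : ℝ) := by
  have h2 : (2 : ℝ) ≤ p := by exact_mod_cast hp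
  have hs := geom_sum_mul_sub_one p e
  have hpos : (0 : ℝ) < ((∑ t ∈ range (e + 1), p ^ t : ℕ) : ℝ) := by
    have : 0 < ∑ t ∈ range (e + 1), p ^ t :=
      sum_pos (fun t _ => by positivity) (by simp)
    exact_mod_cast this
  rw [Nat.cast_pow, ← hs]
  generalize ((∑ t ∈ range (e + 1), p ^ t : ℕ) : ℝ) = s at *
  have h3 : (p : ℝ) - 1 ≠ 0 := by linarith
  push_cast
  field_simp
  ring

lemma weightSum_ne_one {ι : Type*} [Fintype ι] {Q : ι → Finset ℕ} {e : ℕ → ℕ}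
    (hprime : ∀ i, ∀ p ∈ Q i, p.Prime) (hdisj : ∀ i j, i ≠ j → Disjoint (Q i) (Q j))
    (hcop : ∀ i j, i ≠ j → ∀ p ∈ Q i, ∀ r ∈ Q j, ¬ p ∣ ∑ t ∈ range (e r + 1), r ^ t)
    {A S : Finset ℕ} (hAS : A ⊂ S) (hS : ∀ p ∈ S, ∃ i, p ∈ Q i) :
    weightSum Q (fun p => p ^ (e p + 1)) A S ≠ 1 := by
  have hne : (S \ A).Nonempty := sdiff_nonempty.2 hAS.2
  obtain ⟨p, hpSA, hmax⟩ := exists_max_image (S \ A) id hne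
  simp only [id, mem_sdiff] at hpSA hmax
  obtain ⟨i, hi⟩ := hS p hpSA.1
  have hp := hprime i p hi
  set a : ℕ → ℕ := fun r => if r ∈ A then r ^ e r else if r ∈ S then r - 1 else 1 with ha
  set d : ℕ → ℕ :=
    fun r => if r ∈ A then ∑ t ∈ range (e r + 1), r ^ t else if r ∈ S then r else 1 with hd
  have hw : ∀ j, ∀ r ∈ Q j, weight (fun p => p ^ (e p + 1)) A S r = (a r : ℝ) / d r := by
    intro j r hr
    have hr2 := (hprime j r hr).two_le
    by_cases hA : r ∈ A
    · simp only [weight, ha, hd, hA, hAS.1 hA, if_true]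
      exact weight_prime_pow hr2 (e r)
    · by_cases hrS : r ∈ S
      · simp only [weight, ha, hd, hA, hrS, if_true, if_false, mul_one]
        rw [Nat.cast_sub (by omega), Nat.cast_one]
        have : (r : ℝ) ≠ 0 := by positivity
        field_simp
      · simp [weight, ha, hd, hA, hrS]
  have hsum : weightSum Q (fun p => p ^ (e p + 1)) A S =
      ∑ j, ((∏ r ∈ Q j, a r : ℕ) : ℝ) / ((∏ r ∈ Q j, d r : ℕ) : ℝ) := by
    refine sum_congr rfl fun j _ => ?_
    rw [prod_congr rfl (hw j), prod_div_distrib]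
    push_cast
    rfl
  rw [hsum]
  refine sum_div_ne_one_of_prime_dvd hp _ _ (fun j => prod_pos fun r hr => ?_) i ?_ ?_ ?_
  · have := (hprime j r hr).pos
    simp only [hd]
    split_ifs
    · exact sum_pos (fun t _ => by positivity) (by simp)
    · exact this
    · exact one_pos
  · have : d p = p := by simp [hd, hpSA.1, hpSA.2]
    exact this ▸ dvd_prod_of_mem d hi
  · intro hdvd
    obtain ⟨r, hr, hpr⟩ := (hp.prime.dvd_finsetProd_iff _).1 hdvd
    have hrp := hprime i r hr
    simp only [ha] at hpr
    split_ifs at hpr with h1 h2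
    · have := (Nat.prime_dvd_prime_iff_eq hp hrp).1 (hp.dvd_of_dvd_pow hpr)
      exact hpSA.2 (this ▸ h1)
    · have h3 := Nat.le_of_dvd (by have := hrp.two_le; omega) hpr
      have h4 := hmax r ⟨h2, h1⟩
      have := hrp.two_le
      omega
    · exact hp.one_lt.ne' (Nat.dvd_one.1 hpr)
  · intro j hji hdvd
    obtain ⟨r, hr, hpr⟩ := (hp.prime.dvd_finsetProd_iff _).1 hdvd
    have hrp := hprime j r hr
    simp only [hd] at hpr
    split_ifs at hpr with h1 h2
    · exact hcop i j hji.symm p hi r hr hpr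
    · have := (Nat.prime_dvd_prime_iff_eq hp hrp).1 hpr
      exact disjoint_left.1 (hdisj i j hji.symm) hi (this ▸ hr)
    · exact hp.one_lt.ne' (Nat.dvd_one.1 hpr)

lemma sigma_eq_prod {n : ℕ} (hn : n ≠ 0) :
    sigma n = ∏ p ∈ n.primeFactors, ∑ t ∈ range (n.factorization p + 1), p ^ t :=
  Nat.sum_divisors hn

theorem amicable_tuples_stmt14 (k : ℕ) (hk : 2 ≤ k) (M : Fin k → ℕ)
    (hpos : ∀ i, 0 < M i) (hdist : Function.Injective M)
    (hanarchy : ∀ i j, i ≠ j → Nat.gcd (M i) (M j * sigma (M j)) = 1)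
    (hharm : ∑ i, (M i : ℝ) / (sigma (M i) : ℝ) = 1)
    (K : ℕ) (hK : K = (∏ i, M i).primeFactors.card) :
    (sigma (∏ i, M i) : ℝ) * (PhiS (∏ i, M i).primeFactors : ℝ) /
        (PiS (∏ i, M i).primeFactors : ℝ) ≤
      F (2 * K) 2 * (2 : ℝ) ^ (-(2 * 2 ^ K : ℤ)) := by
  subst hK
  have hN : ∏ i, M i ≠ 0 := prod_ne_zero_iff.2 fun i _ => (hpos i).ne'
  set N := ∏ i, M i with hNdef
  set e : ℕ → ℕ := fun p => N.factorization p with he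
  have hdvd : ∀ i, M i ∣ N := fun i => dvd_prod_of_mem M (mem_univ i)
  have hcopM : ∀ i j, i ≠ j → Nat.Coprime (M i) (M j) := fun i j hij =>
    Nat.Coprime.coprime_mul_right_right (hanarchy i j hij)
  have hcopS : ∀ i j, i ≠ j → Nat.Coprime (M i) (sigma (M j)) := fun i j hij =>
    Nat.Coprime.coprime_mul_left_right (hanarchy i j hij)
  have hprime : ∀ i, ∀ p ∈ (M i).primeFactors, p.Prime := fun i p hp =>
    Nat.prime_of_mem_primeFactors hp
  have hdisj : ∀ i j, i ≠ j → Disjoint (M i).primeFactors (M j).primeFactors := fun i j hij =>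
    (hcopM i j hij).disjoint_primeFactors
  have hexp : ∀ i, ∀ p ∈ (M i).primeFactors, (M i).factorization p = e p := by
    intro i p hp
    simp only [he]
    rw [hNdef, Nat.factorization_prod fun j _ => (hpos j).ne', Finsupp.finsetSum_apply]
    symm
    refine sum_eq_single_of_mem i (mem_univ i) fun j _ hji => ?_
    refine Nat.factorization_eq_zero_of_not_dvd fun h => ?_
    exact disjoint_left.1 (hdisj i j hji.symm) hp
      (Nat.mem_primeFactors.2 ⟨hprime i p hp, h, (hpos j).ne'⟩)
  have hsig : ∀ i, sigma (M i) = ∏ p ∈ (M i).primeFactors, ∑ t ∈ range (e p + 1), p ^ t := by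
    intro i
    rw [sigma_eq_prod (hpos i).ne']
    exact prod_congr rfl fun p hp => by rw [hexp i p hp]
  have hMprod : ∀ i, M i = ∏ p ∈ (M i).primeFactors, p ^ e p := by
    intro i
    conv_lhs => rw [← Nat.prod_factorization_pow_eq_self (hpos i).ne']
    rw [Nat.prod_factorization_eq_prod_primeFactors]
    exact prod_congr rfl fun p hp => by rw [hexp i p hp]
  have hQP : ∀ i, (M i).primeFactors ⊆ N.primeFactors := fun i =>
    Nat.primeFactors_mono (hdvd i) hN
  have hPQ : ∀ p ∈ N.primeFactors, ∃ i, p ∈ (M i).primeFactors := by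
    intro p hp
    have hpp := Nat.prime_of_mem_primeFactors hp
    obtain ⟨i, -, hi⟩ := (hpp.prime.dvd_finsetProd_iff _).1 (Nat.dvd_of_mem_primeFactors hp)
    exact ⟨i, Nat.mem_primeFactors.2 ⟨hpp, hi, (hpos i).ne'⟩⟩
  have hP : ∀ p ∈ N.primeFactors, 2 ≤ p ∧ p < p ^ (e p + 1) := by
    intro p hp
    have hpp := Nat.prime_of_mem_primeFactors hp
    have he1 : 0 < e p := hpp.factorization_pos_of_dvd hN (Nat.dvd_of_mem_primeFactors hp)
    exact ⟨hpp.two_le, lt_self_pow₀ hpp.one_lt (by omega)⟩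
  have hone : weightSum (fun i => (M i).primeFactors) (fun p => p ^ (e p + 1))
      N.primeFactors N.primeFactors = 1 := by
    rw [← hharm]
    refine sum_congr rfl fun i _ => ?_
    have h1 : (M i : ℝ) = ∏ p ∈ (M i).primeFactors, (p : ℝ) ^ e p := by exact_mod_cast hMprod i
    have h2 : (sigma (M i) : ℝ) =
        ∏ p ∈ (M i).primeFactors, ∑ t ∈ range (e p + 1), (p : ℝ) ^ t := by exact_mod_cast hsig i
    refine Eq.trans ?_ (congrArg₂ (· / ·) h1 h2).symm
    simp only
    rw [← prod_div_distrib]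
    refine prod_congr rfl fun p hp => ?_
    have hpN := hQP i hp
    simp only [weight, hpN, if_true]
    have := weight_prime_pow (hprime i p hp).two_le (e p)
    push_cast at this ⊢
    exact this
  have hPne : N.primeFactors.Nonempty := by
    rw [Nat.nonempty_primeFactors]
    by_contra hcon
    have hN1 : N = 1 := by omega
    have h1 : ∀ i, M i = 1 := fun i => Nat.dvd_one.1 (hN1 ▸ hdvd i)
    have h01 : (⟨0, by omega⟩ : Fin k) = ⟨1, by omega⟩ := hdist (by rw [h1, h1])
    simp at h01
  have : Nonempty (Fin k) := ⟨⟨0, by omega⟩⟩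
  have hmain := prod_sub_one_div_prod_le hQP hPQ hPne hP hone
    (fun A S hAS hSP => weightSum_ne_one hprime hdisj
      (fun i j hij p hp r hr hpr => by
        have h1 : p ∣ sigma (M j) := by
          rw [hsig j]
          exact hpr.trans (dvd_prod_of_mem (fun r => ∑ t ∈ range (e r + 1), r ^ t) hr)
        exact (hprime i p hp).one_lt.ne' (Nat.dvd_one.1
          (hcopS i j hij ▸ Nat.dvd_gcd (Nat.dvd_of_mem_primeFactors hp) h1)))
      hAS fun p hp => hPQ p (hSP hp))
  have hnum : (sigma N : ℝ) * (PhiS N.primeFactors : ℝ) =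
      ((∏ p ∈ N.primeFactors, (p ^ (e p + 1) - 1) : ℕ) : ℝ) := by
    rw [sigma_eq_prod hN, PhiS, Nat.cast_prod, Nat.cast_prod, Nat.cast_prod, ← prod_mul_distrib]
    refine prod_congr rfl fun p hp => ?_
    have h2 := hP p hp
    rw [Nat.cast_sub (by omega), Nat.cast_sub (by omega), Nat.cast_one,
      geom_sum_mul_sub_one, Nat.cast_pow]
  rw [hnum, PiS]
  refine hmain.trans (le_of_eq ?_)
  rw [div_eq_mul_inv, zpow_neg, ← pow_mul, mul_comm (2 ^ _) 2]
  norm_cast
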